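/- arXiv:1302.0426 — 3 statements merged into one kernel-verified Lean document; each statement's English description precedes it below -/
import Mathlib

section
/- Let H be a complex Hilbert space, D a densely defined symmetric unbounded operator on H, and J : H → H a conjugate-linear norm-preserving map with J ∘ J = −id_H, J(dom(D)) ⊆ dom(D), and J(D ξ) = D(J ξ) for all ξ ∈ dom(D). Then D admits a self-adjoint extension. -/
open ComplexInnerProductSpace

namespace LinearPMap

variable {H : Type*} [NormedAddCommGroup H] [InnerProductSpace ℂ H]

/-- The graph of the inverse Cayley transform of a unitary operator. -/
def cayleyGraph (W : H ≃ₗᵢ[ℂ] H) : Submodule ℂ (H × H) :=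
  LinearMap.range ((LinearMap.id - W.toLinearEquiv.toLinearMap).prod
    (Complex.I • (LinearMap.id + W.toLinearEquiv.toLinearMap)))

theorem mem_cayleyGraph_iff (W : H ≃ₗᵢ[ℂ] H) (x : H × H) :
    x ∈ cayleyGraph W ↔ W (x.2 + Complex.I • x.1) = x.2 - Complex.I • x.1 := by
  obtain ⟨x, y⟩ := x
  constructor
  · rintro ⟨u, hu⟩
    obtain rfl : u - W u = x := congrArg Prod.fst hu
    obtain rfl : Complex.I • (u + W u) = y := congrArg Prod.snd hu
    simp only [W.map_add, W.map_sub, W.map_smul]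
    module
  · intro h
    dsimp only at h
    have hI : Complex.I * Complex.I = -1 := Complex.I_mul_I
    refine ⟨(-Complex.I / 2) • (y + Complex.I • x), Prod.ext ?_ ?_⟩
    · change (-Complex.I / 2) • (y + Complex.I • x) -
        W ((-Complex.I / 2) • (y + Complex.I • x)) = x
      rw [W.map_smul, h]
      match_scalars
      · ring
      · linear_combination (-1) * hI
    · change Complex.I • ((-Complex.I / 2) • (y + Complex.I • x) +
        W ((-Complex.I / 2) • (y + Complex.I • x))) = y
      rw [W.map_smul, h]
      match_scalars
      · linear_combination (-1) * hI
      · ring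

theorem adjoint_cayleyGraph (W : H ≃ₗᵢ[ℂ] H) : (cayleyGraph W).adjoint = cayleyGraph W := by
  ext ⟨x, y⟩
  have key : ∀ u : H, ⟪Complex.I • (u + W u), x⟫ - ⟪u - W u, y⟫ =
      ⟪W u, y - Complex.I • x - W (y + Complex.I • x)⟫ := by
    intro u
    rw [inner_sub_right (W u), W.inner_map_map]
    simp only [inner_smul_left, inner_smul_right, inner_add_left, inner_sub_left, inner_add_right,
      inner_sub_right, Complex.conj_I]
    ring
  rw [Submodule.mem_adjoint_iff, mem_cayleyGraph_iff]
  constructor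
  · intro h
    have h0 : ∀ v : H, ⟪v, y - Complex.I • x - W (y + Complex.I • x)⟫ = 0 := by
      intro v
      rw [← W.apply_symm_apply v, ← key]
      exact h _ _ ⟨W.symm v, rfl⟩
    exact (sub_eq_zero.mp (inner_self_eq_zero.mp (h0 _))).symm
  · rintro h _ _ ⟨u, hu⟩
    obtain ⟨rfl, rfl⟩ := Prod.mk.inj hu
    refine (key u).trans ?_
    dsimp only at h
    rw [h, sub_self, inner_zero_right]

/-- A densely defined operator whose Cayley transform extends to a unitary operator has a
self-adjoint extension. -/
theorem exists_selfAdjoint_extension_of_cayley [CompleteSpace H] (D : H →ₗ.[ℂ] H)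
    (hdense : Dense (D.domain : Set H)) (W : H ≃ₗᵢ[ℂ] H)
    (hW : ∀ ξ : D.domain, W (D ξ + Complex.I • (ξ : H)) = D ξ - Complex.I • (ξ : H)) :
    ∃ T : H →ₗ.[ℂ] H, Dense (T.domain : Set H) ∧ D ≤ T ∧ T.adjoint = T := by
  have hle : D.graph ≤ cayleyGraph W := by
    intro x hx
    obtain ⟨ξ, h₁, h₂⟩ := (LinearPMap.mem_graph_iff D).mp hx
    rw [mem_cayleyGraph_iff, ← h₁, ← h₂]
    exact hW ξ
  have hgraph : (cayleyGraph W).toLinearPMap.graph = cayleyGraph W := by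
    refine Submodule.toLinearPMap_graph_eq _ fun x hx hx0 => ?_
    rw [← adjoint_cayleyGraph, Submodule.mem_adjoint_iff] at hx
    refine hdense.eq_zero_of_inner_right ℂ fun a ha => ?_
    simpa [hx0] using hx a (D ⟨a, ha⟩) (hle (D.mem_graph ⟨a, ha⟩))
  have hDT : D ≤ (cayleyGraph W).toLinearPMap :=
    LinearPMap.le_of_le_graph (hle.trans hgraph.ge)
  have hT : Dense ((cayleyGraph W).toLinearPMap.domain : Set H) := hdense.mono hDT.1
  refine ⟨_, hT, hDT, LinearPMap.eq_of_eq_graph ?_⟩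
  rw [LinearPMap.adjoint_graph_eq_graph_adjoint hT, hgraph, adjoint_cayleyGraph]

end LinearPMap

section

variable {E H : Type*} [AddCommGroup E] [Module ℂ E] [NormedAddCommGroup H] [InnerProductSpace ℂ H]

theorem Orthonormal.norm_sq_add_linearCombination {ι : Type*} {A : E →ₗ[ℂ] H} {v : ι → H}
    (hv : Orthonormal ℂ v) (hAv : ∀ x i, ⟪A x, v i⟫ = 0) (x : E) (l : ι →₀ ℂ) :
    ‖A x + Finsupp.linearCombination ℂ v l‖ ^ 2 =
      ‖A x‖ ^ 2 + (l.sum fun _ c => starRingEnd ℂ c * c).re := by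
  have h0 : ⟪A x, Finsupp.linearCombination ℂ v l⟫ = 0 := by
    simp [Finsupp.linearCombination_apply, Finsupp.inner_sum, inner_smul_right, hAv]
  have hl : ‖Finsupp.linearCombination ℂ v l‖ ^ 2 =
      (l.sum fun _ c => starRingEnd ℂ c * c).re := by
    rw [← inner_self_eq_norm_sq (𝕜 := ℂ), hv.inner_finsupp_eq_sum_left, RCLike.re_eq_complex_re]
    rfl
  rw [← hl, sq, sq, sq]
  exact norm_add_sq_eq_norm_sq_add_norm_sq_of_inner_eq_zero _ _ h0

variable [CompleteSpace H]

theorem denseRange_coprod_linearCombination {ι : Type*} {A : E →ₗ[ℂ] H} {v : ι → H}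
    (htot : ∀ y, (∀ x, ⟪A x, y⟫ = 0) → (∀ i, ⟪v i, y⟫ = 0) → y = 0) :
    DenseRange (A.coprod (Finsupp.linearCombination ℂ v)) := by
  change Dense (LinearMap.range (A.coprod (Finsupp.linearCombination ℂ v)) : Set H)
  rw [Submodule.dense_iff_topologicalClosure_eq_top, Submodule.topologicalClosure_eq_top_iff,
    Submodule.eq_bot_iff]
  intro y hy
  rw [Submodule.mem_orthogonal] at hy
  refine htot y (fun x => hy _ ⟨(x, 0), by simp⟩) fun i => hy _ ⟨(0, Finsupp.single i 1), by simp⟩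

/-- Two linear maps of equal norms whose ranges have orthogonal complements with orthonormal bases
indexed by the same type are intertwined by a unitary operator. -/
theorem exists_linearIsometryEquiv_of_orthonormal {ι : Type*} {A B : E →ₗ[ℂ] H} {v w : ι → H}
    (hAB : ∀ x, ‖A x‖ = ‖B x‖) (hv : Orthonormal ℂ v) (hw : Orthonormal ℂ w)
    (hAv : ∀ x i, ⟪A x, v i⟫ = 0) (hBw : ∀ x i, ⟪B x, w i⟫ = 0)
    (hA : ∀ y, (∀ x, ⟪A x, y⟫ = 0) → (∀ i, ⟪v i, y⟫ = 0) → y = 0)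
    (hB : ∀ y, (∀ x, ⟪B x, y⟫ = 0) → (∀ i, ⟪w i, y⟫ = 0) → y = 0) :
    ∃ W : H ≃ₗᵢ[ℂ] H, ∀ x, W (A x) = B x := by
  have hnorm : ∀ z : E × (ι →₀ ℂ), ‖B.coprod (Finsupp.linearCombination ℂ w)
      z‖ = ‖A.coprod (Finsupp.linearCombination ℂ v) z‖ := by
    rintro ⟨x, l⟩
    rw [← sq_eq_sq₀ (norm_nonneg _) (norm_nonneg _)]
    rw [LinearMap.coprod_apply, LinearMap.coprod_apply, hv.norm_sq_add_linearCombination hAv, hw.norm_sq_add_linearCombination hBw, hAB]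
  have hdA := denseRange_coprod_linearCombination hA
  have hdB := denseRange_coprod_linearCombination hB
  refine ⟨(LinearEquiv.refl ℂ (E × (ι →₀ ℂ))).extendOfIsometry
    (A.coprod (Finsupp.linearCombination ℂ v)) (B.coprod (Finsupp.linearCombination ℂ w))
    hdA hdB hnorm, fun x => ?_⟩
  have h := (LinearEquiv.refl ℂ (E × (ι →₀ ℂ))).extendOfIsometry_eq
    (A.coprod (Finsupp.linearCombination ℂ v)) (B.coprod (Finsupp.linearCombination ℂ w))
    hdA hdB hnorm (x, 0)
  simpa only [LinearEquiv.refl_apply, LinearMap.coprod_apply, map_zero, add_zero] using h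

/-- A closed subspace of a Hilbert space has a total orthonormal family. -/
theorem Submodule.exists_orthonormal_total (K : Submodule ℂ H) (hK : IsClosed (K : Set H)) :
    ∃ (s : Set K) (v : s → H), Orthonormal ℂ v ∧ (∀ i, v i ∈ K) ∧
      ∀ y ∈ K, (∀ i, ⟪v i, y⟫ = 0) → y = 0 := by
  have : CompleteSpace K := hK.completeSpace_coe
  obtain ⟨s, b, -⟩ := exists_hilbertBasis ℂ K
  refine ⟨s, fun i => (b i : H), b.orthonormal.comp_linearIsometry K.subtypeₗᵢ,
    fun i => (b i).2, fun y hy h => ?_⟩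
  have h0 : b.repr ⟨y, hy⟩ = 0 := by
    ext i
    rw [b.repr_apply_apply]
    exact h i
  exact congrArg Subtype.val (b.repr.map_eq_zero_iff.mp h0)

end

/-- A densely defined symmetric operator `D` on a complex Hilbert space
admitting a conjugate-linear norm-preserving map `J` with `J ∘ J = −id`,
`J (dom D) ⊆ dom D` and `J` commuting with `D` on the domain, admits a
self-adjoint extension. -/
theorem stmt_2 {H : Type*} [NormedAddCommGroup H] [InnerProductSpace ℂ H] [CompleteSpace H]
    (D : H →ₗ.[ℂ] H)
    (hdense : Dense (D.domain : Set H))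
    (hsymm : ∀ ξ η : D.domain, ⟪D ξ, (η : H)⟫ = ⟪(ξ : H), D η⟫)
    (J : H → H)
    (hJadd : ∀ ξ η : H, J (ξ + η) = J ξ + J η)
    (hJsmul : ∀ (c : ℂ) (ξ : H), J (c • ξ) = (starRingEnd ℂ) c • J ξ)
    (hJnorm : ∀ ξ η : H, ⟪J ξ, J η⟫ = ⟪η, ξ⟫)
    (hJJ : ∀ ξ : H, J (J ξ) = -ξ)
    (hJdom : ∀ ξ ∈ D.domain, J ξ ∈ D.domain)
    (hJD : ∀ ξ : D.domain, J (D ξ) = D ⟨J ξ, hJdom ξ ξ.2⟩) :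
    ∃ Dtilde : H →ₗ.[ℂ] H,
      Dense (Dtilde.domain : Set H) ∧ D ≤ Dtilde ∧ Dtilde.adjoint = Dtilde := by
  let A : D.domain →ₗ[ℂ] H := D.toFun + Complex.I • D.domain.subtype
  let B : D.domain →ₗ[ℂ] H := D.toFun - Complex.I • D.domain.subtype
  have hA : ∀ ξ, A ξ = D ξ + Complex.I • (ξ : H) := fun _ => rfl
  have hB : ∀ ξ, B ξ = D ξ - Complex.I • (ξ : H) := fun _ => rfl
  have hAB : ∀ ξ, ‖A ξ‖ = ‖B ξ‖ := by
    intro ξ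
    have h : ⟪A ξ, A ξ⟫ = ⟪B ξ, B ξ⟫ := by
      simp only [hA, hB, inner_add_left, inner_add_right, inner_sub_left, inner_sub_right,
        inner_smul_left, inner_smul_right, Complex.conj_I, hsymm ξ ξ]
      ring
    rw [inner_self_eq_norm_sq_to_K, inner_self_eq_norm_sq_to_K] at h
    exact (sq_eq_sq₀ (norm_nonneg _) (norm_nonneg _)).mp (by exact_mod_cast h)
  have hJA : ∀ ξ : D.domain, J (A ξ) = B ⟨J ξ, hJdom ξ ξ.2⟩ := by
    intro ξ
    rw [hA, hB, hJadd, hJsmul, hJD, Complex.conj_I, neg_smul, sub_eq_add_neg]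
  have hJB : ∀ ξ : D.domain, J (B ξ) = A ⟨J ξ, hJdom ξ ξ.2⟩ := by
    intro ξ
    rw [hA, hB, sub_eq_add_neg, ← neg_smul, hJadd, hJsmul, hJD, map_neg, Complex.conj_I, neg_neg]
  have hJinner : ∀ x y, ⟪J x, y⟫ = -⟪J y, x⟫ := by
    intro x y
    rw [← hJnorm x (J y), hJJ, inner_neg_right, neg_neg]
  obtain ⟨s, v, hv, hvmem, hvtot⟩ := (LinearMap.range A)ᗮ.exists_orthonormal_total
    (Submodule.isClosed_orthogonal _)
  have hAv : ∀ ξ i, ⟪A ξ, v i⟫ = 0 := fun ξ i =>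
    (Submodule.mem_orthogonal _ _).mp (hvmem i) _ ⟨ξ, rfl⟩
  have htot : ∀ y, (∀ ξ, ⟪A ξ, y⟫ = 0) → (∀ i, ⟪v i, y⟫ = 0) → y = 0 := by
    refine fun y hy => hvtot y ((Submodule.mem_orthogonal _ _).mpr ?_)
    rintro _ ⟨ξ, rfl⟩
    exact hy ξ
  have hJv : Orthonormal ℂ (fun i => J (v i)) := by
    classical
    rw [orthonormal_iff_ite] at hv ⊢
    intro i j
    rw [hJnorm, hv]
    simp only [eq_comm]
  obtain ⟨W, hW⟩ := exists_linearIsometryEquiv_of_orthonormal hAB hv hJv hAv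
    (fun ξ i => by
      rw [← inner_conj_symm, hJinner, hJB, hAv, neg_zero, map_zero]) htot
    (fun y hy hvy => by
      have h0 : J y = 0 := by
        refine htot _ (fun ξ => ?_) fun i => ?_
        · rw [← inner_conj_symm, hJinner, hJA, hy, neg_zero, map_zero]
        · rw [← inner_conj_symm, hJinner, hvy, neg_zero, map_zero]
      rw [← neg_eq_zero, ← hJJ, h0]
      simpa using hJsmul 0 0)
  exact LinearPMap.exists_selfAdjoint_extension_of_cayley D hdense W hW
end

section
/- Let H be a complex Hilbert space and D a densely defined symmetric unbounded operator on H with domain dom(D). Suppose there is a family (P_i)_{i ∈ I} of orthogonal projections on H (bounded self-adjoint idempotents) such that: (1) each P_i has finite-dimensional range; (2) the ranges are pairwise orthogonal (P_i P_j = 0 for i ≠ j); (3) the closed linear span of the union of the ranges is all of H; (4) the range of each P_i is contained in dom(D); (5) P_i maps dom(D) into dom(D) and P_i(D ξ) = D(P_i ξ) for every ξ ∈ dom(D) and every i. Then the ranges of D + i·id and D − i·id (defined on dom(D)) are dense in H; consequently D is essentially self-adjoint, i.e. its closure is self-adjoint. -/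
open ComplexInnerProductSpace

namespace Submodule

variable {𝕜 E F : Type*} [RCLike 𝕜] [NormedAddCommGroup E] [InnerProductSpace 𝕜 E]
  [NormedAddCommGroup F] [InnerProductSpace 𝕜 F]

theorem adjoint_topologicalClosure (g : Submodule 𝕜 (E × F)) :
    g.topologicalClosure.adjoint = g.adjoint := by
  ext p
  simp only [mem_adjoint_iff]
  refine ⟨fun h a b hab => h a b (g.le_topologicalClosure hab), fun h a b hab => ?_⟩
  have hcl : IsClosed {q : E × F | inner 𝕜 q.2 p.1 - inner 𝕜 q.1 p.2 = 0} :=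
    isClosed_eq (by fun_prop) continuous_const
  exact closure_minimal (fun q hq => h q.1 q.2 hq) hcl hab

theorem isClosed_adjoint (g : Submodule 𝕜 (E × F)) : IsClosed (g.adjoint : Set (F × E)) := by
  have : (g.adjoint : Set (F × E)) =
      ⋂ q ∈ g, {p : F × E | inner 𝕜 q.2 p.1 - inner 𝕜 q.1 p.2 = 0} := by
    ext p
    simp [mem_adjoint_iff]
  rw [this]
  exact isClosed_biInter fun q _ => isClosed_eq (by fun_prop) continuous_const

/-- A closed subspace of a product of Hilbert spaces contains any larger subspace in which it has
trivial orthogonal complement, for the `L²` inner product of the product. -/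
theorem le_of_orthogonal_eq_zero [CompleteSpace E] [CompleteSpace F] {g k : Submodule 𝕜 (E × F)}
    (hg : IsClosed (g : Set (E × F))) (hgk : g ≤ k)
    (h : ∀ p ∈ k, (∀ q ∈ g, inner 𝕜 q.1 p.1 + inner 𝕜 q.2 p.2 = 0) → p = 0) : k ≤ g := by
  intro p hp
  let G : Submodule 𝕜 (WithLp 2 (E × F)) := g.comap (WithLp.linearEquiv 2 𝕜 (E × F)).toLinearMap
  have hG : IsClosed (G : Set (WithLp 2 (E × F))) :=
    hg.preimage (WithLp.prod_continuous_ofLp 2 E F)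
  have : CompleteSpace G := hG.completeSpace_coe
  obtain ⟨y, hy, z, hz, hyz⟩ := G.exists_add_mem_mem_orthogonal (WithLp.toLp 2 p)
  have hp' : p = y.ofLp + z.ofLp := congrArg WithLp.ofLp hyz
  have hyg : y.ofLp ∈ g := hy
  have hz0 : z.ofLp = 0 := by
    refine h _ ?_ fun q hq => ?_
    · rw [← add_sub_cancel_left y.ofLp z.ofLp, ← hp']
      exact k.sub_mem hp (hgk hyg)
    · simpa [WithLp.prod_inner_apply] using hz (WithLp.toLp 2 q) hq
  simpa [hp', hz0] using hyg

end Submodule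

namespace LinearPMap

variable {H : Type*} [NormedAddCommGroup H] [InnerProductSpace ℂ H] {D : H →ₗ.[ℂ] H}

/-- A symmetric operator shifted by a non-real number maps any finite-dimensional invariant
subspace of its domain onto itself. -/
theorem IsFormalAdjoint.le_range_add_smul (hD : D.IsFormalAdjoint D) {c : ℂ} (hc : c.im ≠ 0)
    {V : Submodule ℂ H} [FiniteDimensional ℂ V] (hV : V ≤ D.domain)
    (hinv : ∀ ξ : D.domain, (ξ : H) ∈ V → D ξ ∈ V) :
    V ≤ (D.toFun + c • D.domain.subtype).range := by
  let T : V →ₗ[ℂ] V :=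
    ((D.toFun + c • D.domain.subtype) ∘ₗ Submodule.inclusion hV).codRestrict V fun v =>
      V.add_mem (hinv _ v.2) (V.smul_mem c v.2)
  have hT : Function.Injective T := by
    rw [← LinearMap.ker_eq_bot, LinearMap.ker_eq_bot']
    intro v hv
    have hDv : D ⟨v, hV v.2⟩ = -(c • (v : H)) :=
      eq_neg_of_add_eq_zero_left (congrArg Subtype.val hv)
    have hs := hD ⟨v, hV v.2⟩ ⟨v, hV v.2⟩
    simp only [hDv, inner_neg_left, inner_neg_right, inner_smul_left, inner_smul_right,
      neg_inj] at hs
    by_contra hne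
    have h0 : (inner ℂ (v : H) (v : H)) ≠ 0 := by simpa using hne
    exact hc (Complex.conj_eq_iff_im.mp (mul_right_cancel₀ h0 hs))
  intro v hv
  obtain ⟨w, hw⟩ := LinearMap.injective_iff_surjective.mp hT ⟨v, hv⟩
  exact ⟨⟨w, hV w.2⟩, congrArg Subtype.val hw⟩

variable [CompleteSpace H]

/-- The basic criterion for essential self-adjointness. -/
theorem IsFormalAdjoint.adjoint_closure_eq_closure (hD : D.IsFormalAdjoint D)
    (hdense : Dense (D.domain : Set H))
    (hpos : Dense {η : H | ∃ ξ : D.domain, D ξ + Complex.I • (ξ : H) = η})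
    (hneg : Dense {η : H | ∃ ξ : D.domain, D ξ - Complex.I • (ξ : H) = η}) :
    D.closure.adjoint = D.closure := by
  have hle : D ≤ D.adjoint := hD.le_adjoint hdense
  have hclosable : D.IsClosable := (adjoint_isClosed hdense).isClosable.leIsClosable hle
  apply eq_of_eq_graph
  rw [adjoint_graph_eq_graph_adjoint (hdense.mono D.le_closure.1),
    ← hclosable.graph_closure_eq_closure_graph, Submodule.adjoint_topologicalClosure]
  have hgraph : D.graph.topologicalClosure ≤ D.graph.adjoint := by
    refine Submodule.topologicalClosure_minimal _ ?_ (Submodule.isClosed_adjoint _)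
    rw [← adjoint_graph_eq_graph_adjoint hdense]
    exact le_graph_of_le hle
  refine le_antisymm (Submodule.le_of_orthogonal_eq_zero
    (Submodule.isClosed_topologicalClosure _) hgraph ?_) hgraph
  rintro ⟨y, z⟩ hyz horth
  rw [Submodule.mem_adjoint_iff] at hyz
  have h₁ (ξ : D.domain) : inner ℂ (D ξ) y = inner ℂ (ξ : H) z :=
    sub_eq_zero.mp (hyz _ _ (D.mem_graph ξ))
  have h₂ (ξ : D.domain) : inner ℂ (ξ : H) y + inner ℂ (D ξ) z = 0 :=
    horth _ (D.graph.le_topologicalClosure (D.mem_graph ξ))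
  have hadd : z + Complex.I • y = 0 := by
    refine hpos.eq_zero_of_inner_right ℂ ?_
    rintro _ ⟨ξ, rfl⟩
    simp only [inner_add_left, inner_add_right, inner_smul_left, inner_smul_right, h₁,
      Complex.conj_I]
    linear_combination h₂ ξ - inner ℂ (ξ : H) y * Complex.I_mul_I
  have hsub : z - Complex.I • y = 0 := by
    refine hneg.eq_zero_of_inner_right ℂ ?_
    rintro _ ⟨ξ, rfl⟩
    simp only [inner_sub_left, inner_sub_right, inner_smul_left, inner_smul_right, h₁,
      Complex.conj_I]
    linear_combination h₂ ξ - inner ℂ (ξ : H) y * Complex.I_mul_I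
  have hz : z = 0 := by
    have h : (2 : ℂ) • z = (z + Complex.I • y) + (z - Complex.I • y) := by
      rw [two_smul]
      abel
    simpa [hadd, hsub] using h
  simpa [hz] using hadd

end LinearPMap

/-- A densely defined symmetric operator `D` on a complex Hilbert
space which commutes with a family of finite-rank orthogonal projections `P_i` whose
pairwise-orthogonal ranges are contained in the domain of `D` and whose ranges have
dense linear span has dense ranges of `D ± i`, and is therefore essentially
self-adjoint (its closure is self-adjoint). -/
theorem stmt_11 {H : Type*} [NormedAddCommGroup H] [InnerProductSpace ℂ H] [CompleteSpace H]
    (D : H →ₗ.[ℂ] H)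
    (hdense : Dense (D.domain : Set H))
    (hsymm : ∀ ξ η : D.domain, ⟪D ξ, (η : H)⟫ = ⟪(ξ : H), D η⟫)
    {ι : Type*} (P : ι → (H →L[ℂ] H))
    -- each `P i` is an orthogonal projection (a self-adjoint idempotent)
    (hidem : ∀ i, P i ∘L P i = P i)
    (hsa : ∀ i, IsSelfAdjoint (P i))
    -- (1) each `P i` has finite-dimensional range
    (hfin : ∀ i, FiniteDimensional ℂ (LinearMap.range ((P i) : H →ₗ[ℂ] H)))
    -- (2) the ranges are pairwise orthogonal
    (horth : ∀ i j, i ≠ j → (P i) ∘L (P j) = 0)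
    -- (3) the closed linear span of the union of the ranges is all of `H`
    (hspan : Dense ((⨆ i, LinearMap.range ((P i) : H →ₗ[ℂ] H) : Submodule ℂ H) : Set H))
    -- (4) the range of each `P i` is contained in the domain of `D`
    (hran : ∀ i, LinearMap.range ((P i) : H →ₗ[ℂ] H) ≤ D.domain)
    -- (5) each `P i` maps the domain into itself and commutes with `D`
    (hmap : ∀ (i : ι) (ξ : D.domain), P i (ξ : H) ∈ D.domain)
    (hcomm : ∀ (i : ι) (ξ : D.domain), P i (D ξ) = D ⟨P i (ξ : H), hmap i ξ⟩) :
    -- the ranges of `D + i` and `D − i` are dense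
    Dense {η : H | ∃ ξ : D.domain, D ξ + Complex.I • (ξ : H) = η} ∧
    Dense {η : H | ∃ ξ : D.domain, D ξ - Complex.I • (ξ : H) = η} ∧
    -- hence `D` is essentially self-adjoint: its closure is self-adjoint
    D.closure.adjoint = D.closure := by
  have hrange (c : ℂ) (hc : c.im ≠ 0) :
      Dense ((D.toFun + c • D.domain.subtype).range : Set H) := by
    refine hspan.mono (SetLike.coe_subset_coe.mpr (iSup_le fun i => ?_))
    have := hfin i
    refine LinearPMap.IsFormalAdjoint.le_range_add_smul hsymm hc (hran i) ?_
    rintro ξ ⟨x, hx⟩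
    have hξ : P i ξ = ξ := by
      rw [← hx]
      exact congrArg (fun f : H →L[ℂ] H => f x) (hidem i)
    refine ⟨D ξ, (hcomm i ξ).trans ?_⟩
    congr 1
    exact Subtype.ext hξ
  have hpos : Dense {η : H | ∃ ξ : D.domain, D ξ + Complex.I • (ξ : H) = η} :=
    hrange Complex.I (by simp)
  have hneg : Dense {η : H | ∃ ξ : D.domain, D ξ - Complex.I • (ξ : H) = η} := by
    convert hrange (-Complex.I) (by simp) using 1
    ext η
    simp [sub_eq_add_neg]
  exact ⟨hpos, hneg, LinearPMap.IsFormalAdjoint.adjoint_closure_eq_closure hsymm hdense hpos hneg⟩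
end

section
/- Let n = 2m be an even positive integer and N = 2^m. There exist N × N complex matrices F_1, …, F_n, an N × N complex matrix γ_S, and a conjugate-linear map J_S : ℂ^N → ℂ^N with the following properties: (a) F_j^* = −F_j and F_j F_k + F_k F_j = −2 δ_{jk} I_N for all j, k; (b) γ_S^* = γ_S, γ_S² = I_N, and γ_S F_j = −F_j γ_S for all j; (c) ⟪J_S s, J_S s'⟫ = ⟪s', s⟫ for all s, s' ∈ ℂ^N, J_S ∘ J_S = ε_J · id, J_S ∘ F_j = ε_D · F_j ∘ J_S for all j, and J_S ∘ γ_S = ε_γ · γ_S ∘ J_S, where the signs are determined by n mod 8 as follows: (ε_J, ε_D, ε_γ) = (+1, +1, +1) if n ≡ 0, (−1, +1, −1) if n ≡ 2, (−1, +1, +1) if n ≡ 4, and (+1, +1, −1) if n ≡ 6 (mod 8). -/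
open Matrix

open scoped Kronecker

/-- Matrices `F` satisfying the Clifford relations `F j * F k + F k * F j = -2 δ_{jk}`, with a
grading `γ` and a charge conjugation `s ↦ C (star s)` commuting with the `F j`, of square `eJ`
and commuting with `γ` up to the factor `eγ`. -/
structure IsRealCliffordModule {ι α : Type*} [DecidableEq ι] [Fintype α] [DecidableEq α]
    (F : ι → Matrix α α ℂ) (γ C : Matrix α α ℂ) (eJ eγ : ℂ) : Prop where
  conjTranspose_gen : ∀ j, (F j)ᴴ = -F j
  gen_anticomm : ∀ j k, F j * F k + F k * F j = if j = k then -(2 : Matrix α α ℂ) else 0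
  conjTranspose_grading : γᴴ = γ
  grading_mul_self : γ * γ = 1
  grading_gen : ∀ j, γ * F j = -(F j * γ)
  unitary : Cᴴ * C = 1
  conj_conj : C * C.map star = eJ • (1 : Matrix α α ℂ)
  conj_gen : ∀ j, C * (F j).map star = F j * C
  conj_grading : C * γ.map star = eγ • (γ * C)

theorem Matrix.kronecker_map_star {α β : Type*} (A : Matrix α α ℂ) (B : Matrix β β ℂ) :
    (A ⊗ₖ B).map star = A.map star ⊗ₖ B.map star := by
  ext ⟨a, b⟩ ⟨c, d⟩
  simp [Matrix.kroneckerMap_apply]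

namespace IsRealCliffordModule

theorem reindex {ι ι' α α' : Type*} [DecidableEq ι] [DecidableEq ι'] [Fintype α] [DecidableEq α]
    [Fintype α'] [DecidableEq α'] {F : ι → Matrix α α ℂ} {γ C : Matrix α α ℂ} {eJ eγ : ℂ}
    (h : IsRealCliffordModule F γ C eJ eγ) (e : ι' ≃ ι) (f : α' ≃ α) :
    IsRealCliffordModule (fun j => (F (e j)).submatrix f f) (γ.submatrix f f) (C.submatrix f f)
      eJ eγ where
  conjTranspose_gen j := by
    rw [conjTranspose_submatrix, h.conjTranspose_gen]; rfl
  gen_anticomm j k := by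
    rw [submatrix_mul_equiv, submatrix_mul_equiv]
    change (F (e j) * F (e k) + F (e k) * F (e j)).submatrix f f = _
    rw [h.gen_anticomm]
    simp only [e.apply_eq_iff_eq]
    split_ifs
    · ext a b
      simp [← Matrix.diagonal_ofNat', Matrix.diagonal_apply]
      split_ifs <;> simp
    · rfl
  conjTranspose_grading := by
    rw [conjTranspose_submatrix, h.conjTranspose_grading]
  grading_mul_self := by
    rw [submatrix_mul_equiv, h.grading_mul_self, submatrix_one_equiv]
  grading_gen j := by
    rw [submatrix_mul_equiv, submatrix_mul_equiv, h.grading_gen]; rfl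
  unitary := by
    rw [conjTranspose_submatrix, submatrix_mul_equiv, h.unitary, submatrix_one_equiv]
  conj_conj := by
    rw [← submatrix_map, submatrix_mul_equiv, h.conj_conj, submatrix_smul, Pi.smul_apply,
      Pi.smul_apply, submatrix_one_equiv]
  conj_gen j := by
    rw [← submatrix_map, submatrix_mul_equiv, submatrix_mul_equiv, h.conj_gen]
  conj_grading := by
    rw [← submatrix_map, submatrix_mul_equiv, submatrix_mul_equiv, h.conj_grading]; rfl

/-- Two further generators `γ ⊗ B b` are added by tensoring with `ℂ²`; the hypotheses say that `B`,
`Γ`, `K` form the corresponding structure on `ℂ²`, twisted by the sign `eγ`. -/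
theorem kronecker {ι κ α β : Type*} [DecidableEq ι] [DecidableEq κ] [Fintype α] [DecidableEq α]
    [Fintype β] [DecidableEq β] {F : ι → Matrix α α ℂ} {γ C : Matrix α α ℂ} {eJ eγ : ℂ}
    (h : IsRealCliffordModule F γ C eJ eγ)
    {B : κ → Matrix β β ℂ} {Γ K : Matrix β β ℂ} {dJ dγ : ℂ}
    (hB : ∀ j, (B j)ᴴ = -B j)
    (hBB : ∀ j k, B j * B k + B k * B j = if j = k then -(2 : Matrix β β ℂ) else 0)
    (hΓ : Γᴴ = Γ) (hΓΓ : Γ * Γ = 1) (hΓB : ∀ j, Γ * B j = -(B j * Γ))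
    (hK : Kᴴ * K = 1) (hKK : K * K.map star = dJ • (1 : Matrix β β ℂ))
    (hKB : ∀ j, eγ • (K * (B j).map star) = B j * K)
    (hKΓ : K * Γ.map star = dγ • (Γ * K)) :
    IsRealCliffordModule (Sum.elim (fun j => F j ⊗ₖ (1 : Matrix β β ℂ)) (fun j => γ ⊗ₖ B j))
      (γ ⊗ₖ Γ) (C ⊗ₖ K) (eJ * dJ) (eγ * dγ) where
  conjTranspose_gen j := by
    rcases j with j | j
    · simp only [Sum.elim_inl, conjTranspose_kronecker, h.conjTranspose_gen, conjTranspose_one]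
      ext; simp [kroneckerMap_apply]
    · simp only [Sum.elim_inr, conjTranspose_kronecker, h.conjTranspose_grading, hB]
      ext; simp [kroneckerMap_apply]
  gen_anticomm j k := by
    rcases j with j | j <;> rcases k with k | k
    · simp only [Sum.elim_inl, ← mul_kronecker_mul, ← add_kronecker, h.gen_anticomm, mul_one,
        Sum.inl.injEq]
      split_ifs
      · ext ⟨a, b⟩ ⟨c, d⟩
        simp [kroneckerMap_apply, ← Matrix.diagonal_ofNat', Matrix.diagonal_apply, Matrix.one_apply,
          Prod.ext_iff]
        split_ifs <;> simp_all
      · simp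
    · simp only [Sum.elim_inl, Sum.elim_inr, ← mul_kronecker_mul, h.grading_gen, mul_one, one_mul]
      ext; simp [kroneckerMap_apply]
    · simp only [Sum.elim_inl, Sum.elim_inr, ← mul_kronecker_mul, h.grading_gen, mul_one, one_mul]
      ext; simp [kroneckerMap_apply]
    · simp only [Sum.elim_inr, ← mul_kronecker_mul, ← kronecker_add, h.grading_mul_self, hBB,
        Sum.inr.injEq]
      split_ifs
      · ext ⟨a, b⟩ ⟨c, d⟩
        simp [kroneckerMap_apply, ← Matrix.diagonal_ofNat', Matrix.diagonal_apply, Matrix.one_apply,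
          Prod.ext_iff]
        split_ifs <;> simp_all
      · simp
  conjTranspose_grading := by
    rw [conjTranspose_kronecker, h.conjTranspose_grading, hΓ]
  grading_mul_self := by
    rw [← mul_kronecker_mul, h.grading_mul_self, hΓΓ, one_kronecker_one]
  grading_gen j := by
    rcases j with j | j
    · simp only [Sum.elim_inl, ← mul_kronecker_mul, h.grading_gen, mul_one, one_mul]
      ext; simp [kroneckerMap_apply]
    · simp only [Sum.elim_inr, ← mul_kronecker_mul, hΓB]
      ext; simp [kroneckerMap_apply]
  unitary := by
    rw [conjTranspose_kronecker, ← mul_kronecker_mul, h.unitary, hK, one_kronecker_one]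
  conj_conj := by
    rw [kronecker_map_star, ← mul_kronecker_mul, h.conj_conj, hKK, smul_kronecker,
      kronecker_smul, one_kronecker_one, smul_smul]
  conj_gen j := by
    rcases j with j | j
    · simp only [Sum.elim_inl, kronecker_map_star, ← mul_kronecker_mul, h.conj_gen, mul_one,
        one_mul, Matrix.map_one star (star_zero ℂ) (star_one ℂ)]
    · simp only [Sum.elim_inr, kronecker_map_star, ← mul_kronecker_mul, h.conj_grading, ← hKB,
        smul_kronecker, kronecker_smul]
  conj_grading := by
    rw [kronecker_map_star, ← mul_kronecker_mul, ← mul_kronecker_mul, h.conj_grading, hKΓ,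
      smul_kronecker, kronecker_smul, smul_smul]

/-- The anticommuting square roots `i σ₁`, `i σ₃` of `-1`. -/
def quaternionGen : Fin 2 → Matrix (Fin 2) (Fin 2) ℂ :=
  ![!![0, Complex.I; Complex.I, 0], !![Complex.I, 0; 0, -Complex.I]]

/-- Two generators can be added to a Clifford module, at the cost of doubling its dimension. -/
theorem exists_kronecker {ι α : Type*} [DecidableEq ι] [Fintype α] [DecidableEq α]
    {F : ι → Matrix α α ℂ} {γ C : Matrix α α ℂ} {eJ eγ : ℂ}
    (h : IsRealCliffordModule F γ C eJ eγ) (heγ : eγ = 1 ∨ eγ = -1) :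
    ∃ (F' : ι ⊕ Fin 2 → Matrix (α × Fin 2) (α × Fin 2) ℂ)
      (γ' C' : Matrix (α × Fin 2) (α × Fin 2) ℂ),
      IsRealCliffordModule F' γ' C' (eJ * -eγ) (eγ * -1) := by
  have key : ∃ K : Matrix (Fin 2) (Fin 2) ℂ, Kᴴ * K = 1 ∧ K * K.map star = (-eγ) • 1 ∧
      (∀ j, eγ • (K * (quaternionGen j).map star) =
        quaternionGen j * K) ∧
      K * (!![0, -Complex.I; Complex.I, 0] : Matrix (Fin 2) (Fin 2) ℂ).map star =
        (-1 : ℂ) • (!![0, -Complex.I; Complex.I, 0] * K) := by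
    rcases heγ with rfl | rfl
    · refine ⟨!![0, 1; -1, 0], ?_, ?_, fun j => ?_, ?_⟩
      all_goals try fin_cases j
      all_goals
        ext a b
        fin_cases a <;> fin_cases b <;>
          simp [Matrix.mul_apply, Fin.sum_univ_two, quaternionGen, vecMul, dotProduct]
    · refine ⟨1, ?_, ?_, fun j => ?_, ?_⟩
      all_goals try fin_cases j
      all_goals
        ext a b
        fin_cases a <;> fin_cases b <;>
          simp [Matrix.mul_apply, Fin.sum_univ_two, quaternionGen]
  obtain ⟨K, hK, hKK, hKB, hKΓ⟩ := key
  refine ⟨_, _, _, h.kronecker ?_ ?_ ?_ ?_ ?_ hK hKK hKB hKΓ⟩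
  · intro j
    ext a b
    fin_cases j <;> fin_cases a <;> fin_cases b <;> simp [quaternionGen]
  · intro j k
    ext a b
    fin_cases j <;> fin_cases k <;> fin_cases a <;> fin_cases b <;>
      simp [quaternionGen, ← Matrix.diagonal_ofNat'] <;> norm_num
  · ext a b
    fin_cases a <;> fin_cases b <;> simp
  · ext a b
    fin_cases a <;> fin_cases b <;> simp [Matrix.mul_apply, Fin.sum_univ_two]
  · intro j
    ext a b
    fin_cases j <;> fin_cases a <;> fin_cases b <;>
      simp [Matrix.mul_apply, Fin.sum_univ_two, quaternionGen]

theorem exists_two_mul (m : ℕ) :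
    ∃ (F : Fin (2 * m) → Matrix (Fin (2 ^ m)) (Fin (2 ^ m)) ℂ)
      (γ C : Matrix (Fin (2 ^ m)) (Fin (2 ^ m)) ℂ),
      IsRealCliffordModule F γ C
        (if 2 * m % 8 = 0 ∨ 2 * m % 8 = 6 then 1 else -1)
        (if 2 * m % 8 = 0 ∨ 2 * m % 8 = 4 then 1 else -1) := by
  induction m with
  | zero =>
    refine ⟨fun _ => 0, 1, 1, fun j => j.elim0, fun j => j.elim0, ?_, ?_, fun j => j.elim0, ?_, ?_,
      fun j => j.elim0, ?_⟩ <;> simp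
  | succ m ih =>
    obtain ⟨F, γ, C, h⟩ := ih
    obtain ⟨F', γ', C', h'⟩ := h.exists_kronecker (by split_ifs <;> simp)
    have e : Fin (2 * (m + 1)) ≃ Fin (2 * m) ⊕ Fin 2 :=
      Fintype.equivOfCardEq (by simp [mul_add])
    have f : Fin (2 ^ (m + 1)) ≃ Fin (2 ^ m) × Fin 2 :=
      Fintype.equivOfCardEq (by simp [pow_succ])
    refine ⟨fun j => (F' (e j)).submatrix f f, γ'.submatrix f f, C'.submatrix f f, ?_⟩
    convert h'.reindex e f using 1
    · split_ifs <;> first | omega | simp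
    · split_ifs <;> first | omega | simp

theorem star_conj_dotProduct {ι α : Type*} [DecidableEq ι] [Fintype α] [DecidableEq α]
    {F : ι → Matrix α α ℂ} {γ C : Matrix α α ℂ} {eJ eγ : ℂ}
    (h : IsRealCliffordModule F γ C eJ eγ) (s t : α → ℂ) :
    star (C *ᵥ star s) ⬝ᵥ (C *ᵥ star t) = star t ⬝ᵥ s := by
  rw [star_mulVec, star_star, ← dotProduct_mulVec, mulVec_mulVec, h.unitary, one_mulVec,
    dotProduct_comm]

end IsRealCliffordModule

theorem Matrix.star_mulVec_eq_map {α β : Type*} [Fintype β] (A : Matrix α β ℂ) (s : β → ℂ) :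
    star (A *ᵥ s) = A.map star *ᵥ star s := by
  ext a
  simp [mulVec, dotProduct]



/-- For even `n = 2m` and `N = 2^m` there exist `N × N` complex
matrices `F_1, …, F_n` generating an irreducible representation of `Cl(n)`
(`F_j^* = −F_j`, `F_j F_k + F_k F_j = −2 δ_{jk}`), a grading `γ_S` (self-adjoint,
squaring to one and anticommuting with the `F_j`), and a conjugate-linear
charge conjugation `J_S` on `ℂ^N` (norm-preserving for the standard Hermitian inner
product) with `J_S² = ε_J`, `J_S F_j = ε_D F_j J_S` and `J_S γ_S = ε_γ γ_S J_S`,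
where the signs `(ε_J, ε_D, ε_γ)` are `(+,+,+)`, `(−,+,−)`, `(−,+,+)`, `(+,+,−)`
according to `n ≡ 0, 2, 4, 6 (mod 8)`. -/
theorem stmt_12 (m n N : ℕ) (hm : 0 < m) (hn : n = 2 * m) (hN : N = 2 ^ m) :
    ∃ (F : Fin n → Matrix (Fin N) (Fin N) ℂ) (γS : Matrix (Fin N) (Fin N) ℂ)
      (JS : (Fin N → ℂ) → (Fin N → ℂ)),
      -- (a) Clifford relations
      (∀ j, (F j)ᴴ = -F j) ∧
      (∀ j k, F j * F k + F k * F j =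
        if j = k then -(2 : Matrix (Fin N) (Fin N) ℂ) else 0) ∧
      -- (b) grading operator
      γSᴴ = γS ∧ γS * γS = 1 ∧ (∀ j, γS * F j = -(F j * γS)) ∧
      -- (c) `J_S` is conjugate-linear and norm-preserving
      (∀ s t : Fin N → ℂ, JS (s + t) = JS s + JS t) ∧
      (∀ (c : ℂ) (s : Fin N → ℂ), JS (c • s) = (starRingEnd ℂ) c • JS s) ∧
      (∀ s t : Fin N → ℂ,
        ∑ a, (starRingEnd ℂ) (JS s a) * JS t a = ∑ a, (starRingEnd ℂ) (t a) * s a) ∧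
      -- `J_S ∘ J_S = ε_J • id`
      (∀ s : Fin N → ℂ,
        JS (JS s) = (if n % 8 = 0 ∨ n % 8 = 6 then (1 : ℂ) else -1) • s) ∧
      -- `J_S ∘ F_j = ε_D • F_j ∘ J_S` with `ε_D = +1` in all even cases
      (∀ (j : Fin n) (s : Fin N → ℂ),
        JS ((F j).mulVec s) = (1 : ℂ) • (F j).mulVec (JS s)) ∧
      -- `J_S ∘ γ_S = ε_γ • γ_S ∘ J_S`
      (∀ s : Fin N → ℂ,
        JS (γS.mulVec s) =
          (if n % 8 = 0 ∨ n % 8 = 4 then (1 : ℂ) else -1) • γS.mulVec (JS s)) := by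
  subst hn hN
  obtain ⟨F, γ, C, h⟩ := IsRealCliffordModule.exists_two_mul m
  refine ⟨F, γ, fun s => C *ᵥ star s, h.conjTranspose_gen, h.gen_anticomm,
    h.conjTranspose_grading, h.grading_mul_self, h.grading_gen, fun s t => ?_, fun c s => ?_,
    h.star_conj_dotProduct, fun s => ?_, fun j s => ?_, fun s => ?_⟩
  · dsimp only
    rw [star_add, mulVec_add]
  · dsimp only
    rw [star_smul, mulVec_smul, starRingEnd_apply]
  · dsimp only
    rw [star_mulVec_eq_map, star_star, mulVec_mulVec, h.conj_conj, smul_mulVec, one_mulVec]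
  · dsimp only
    rw [star_mulVec_eq_map, mulVec_mulVec, h.conj_gen, one_smul, mulVec_mulVec]
  · dsimp only
    rw [star_mulVec_eq_map, mulVec_mulVec, h.conj_grading, smul_mulVec, mulVec_mulVec]
end
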